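/- Let G be an (n,d,λ)-graph with d ≤ n/2. Then the vertex-connectivity of G satisfies κ(G) ≥ d − 36λ²/d. -/

import Mathlib

/-- An `(n,d,λ)`-graph: a `d`-regular graph on `n` vertices all of whose adjacency-matrix
eigenvalues, except the largest one `λ₁ = d`, are at most `lam` in absolute value. -/
def IsNDL {V : Type*} [Fintype V] [DecidableEq V] (G : SimpleGraph V) [DecidableRel G.Adj]
    (n d : ℕ) (lam : ℝ) : Prop :=
  Fintype.card V = n ∧ G.IsRegularOfDegree d ∧
    ∃ (hA : (G.adjMatrix ℝ).IsHermitian) (i₀ : V),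
      hA.eigenvalues i₀ = (d : ℝ) ∧ ∀ i : V, i ≠ i₀ → |hA.eigenvalues i| ≤ lam

open Matrix in
/-- Parseval's identity for the eigenvector basis of a real symmetric matrix. -/
lemma Matrix.IsHermitian.sum_eigenvectorBasis_dotProduct_mul {V : Type*} [Fintype V]
    [DecidableEq V] {A : Matrix V V ℝ} (hA : A.IsHermitian) (x y : V → ℝ) :
    ∑ i, (⇑(hA.eigenvectorBasis i) ⬝ᵥ x) * (⇑(hA.eigenvectorBasis i) ⬝ᵥ y) = x ⬝ᵥ y := by
  have h := hA.eigenvectorBasis.sum_inner_mul_inner (WithLp.toLp 2 x) (WithLp.toLp 2 y)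
  simp only [EuclideanSpace.inner_eq_star_dotProduct, star_trivial] at h
  rw [dotProduct_comm x y, ← h]
  refine Finset.sum_congr rfl fun i _ => ?_
  rw [dotProduct_comm y]

open Matrix in
/-- Pairing an eigenvector of a real symmetric matrix with `A *ᵥ x`. -/
lemma Matrix.IsHermitian.eigenvectorBasis_dotProduct_mulVec {V : Type*} [Fintype V]
    [DecidableEq V] {A : Matrix V V ℝ} (hA : A.IsHermitian) (i : V) (x : V → ℝ) :
    ⇑(hA.eigenvectorBasis i) ⬝ᵥ A *ᵥ x
      = hA.eigenvalues i * (⇑(hA.eigenvectorBasis i) ⬝ᵥ x) := by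
  have hT : Aᵀ = A := by simpa [conjTranspose_eq_transpose_of_trivial] using hA.eq
  rw [dotProduct_mulVec, ← mulVec_transpose, hT, hA.mulVec_eigenvectorBasis, smul_dotProduct,
    smul_eq_mul]

namespace IsNDL

open Matrix

variable {V : Type*} [Fintype V] [DecidableEq V] {G : SimpleGraph V} [DecidableRel G.Adj]
  {n d : ℕ} {lam : ℝ}

lemma adjMatrix_mulVec_one (h : IsNDL G n d lam) :
    G.adjMatrix ℝ *ᵥ (1 : V → ℝ) = (d : ℝ) • 1 := by
  ext v
  have := SimpleGraph.adjMatrix_mulVec_const_apply_of_regular (a := (1 : ℝ)) h.2.1 (v := v)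
  simpa [Function.const_one] using! this

lemma one_dotProduct_adjMatrix_mulVec (h : IsNDL G n d lam) (x : V → ℝ) :
    1 ⬝ᵥ G.adjMatrix ℝ *ᵥ x = d * (1 ⬝ᵥ x) := by
  rw [dotProduct_mulVec, ← mulVec_transpose, SimpleGraph.transpose_adjMatrix,
    h.adjMatrix_mulVec_one, smul_dotProduct, smul_eq_mul]

/-- The adjacency matrix contracts vectors of sum zero by a factor `lam`. -/
lemma adjMatrix_mulVec_dotProduct_self_le (h : IsNDL G n d lam) (hlam : lam < d)
    {x : V → ℝ} (hx : 1 ⬝ᵥ x = 0) :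
    (G.adjMatrix ℝ *ᵥ x) ⬝ᵥ (G.adjMatrix ℝ *ᵥ x) ≤ lam ^ 2 * (x ⬝ᵥ x) := by
  obtain ⟨-, -, hA, i₀, -, hle⟩ := id h
  have horth : ∀ i, i ≠ i₀ → ⇑(hA.eigenvectorBasis i) ⬝ᵥ (1 : V → ℝ) = 0 := by
    intro i hi
    have h1 := hA.eigenvectorBasis_dotProduct_mulVec i 1
    rw [h.adjMatrix_mulVec_one, dotProduct_smul, smul_eq_mul] at h1
    have h2 : hA.eigenvalues i < d := (le_abs_self _).trans_lt ((hle i hi).trans_lt hlam)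
    exact (mul_eq_mul_right_iff.mp h1).resolve_left h2.ne'
  have hone (y : V → ℝ) : (⇑(hA.eigenvectorBasis i₀) ⬝ᵥ (1 : V → ℝ))
      * (⇑(hA.eigenvectorBasis i₀) ⬝ᵥ y) = 1 ⬝ᵥ y := by
    rw [← hA.sum_eigenvectorBasis_dotProduct_mul 1 y, Finset.sum_eq_single i₀]
    · intro i _ hi
      rw [horth i hi, zero_mul]
    · simp
  have hx₀ : ⇑(hA.eigenvectorBasis i₀) ⬝ᵥ x = 0 := by
    have h1 := hone x
    rw [hx] at h1
    refine (mul_eq_zero.mp h1).resolve_left fun h0 => ?_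
    have h2 := hone 1
    have : Nonempty V := ⟨i₀⟩
    rw [h0, zero_mul] at h2
    simp [eq_comm] at h2
  rw [← hA.sum_eigenvectorBasis_dotProduct_mul, ← hA.sum_eigenvectorBasis_dotProduct_mul x x,
    Finset.mul_sum]
  refine Finset.sum_le_sum fun i _ => ?_
  rw [hA.eigenvectorBasis_dotProduct_mulVec]
  obtain rfl | hi := eq_or_ne i i₀
  · simp [hx₀]
  · have h1 : hA.eigenvalues i ^ 2 ≤ lam ^ 2 := by
      rw [← sq_abs]
      exact pow_le_pow_left₀ (abs_nonneg _) (hle i hi) 2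
    nlinarith [mul_le_mul_of_nonneg_right h1 (sq_nonneg (⇑(hA.eigenvectorBasis i) ⬝ᵥ x))]

/-- The expander mixing lemma, for weighted vertex sets. -/
lemma sq_mixing_le (h : IsNDL G n d lam) (hlam : lam < d) (f g : V → ℝ) :
    (f ⬝ᵥ G.adjMatrix ℝ *ᵥ g - d * (1 ⬝ᵥ f) * (1 ⬝ᵥ g) / n) ^ 2
      ≤ lam ^ 2 * (f ⬝ᵥ f) * (g ⬝ᵥ g) := by
  have hn : (0 : ℝ) < n := by
    obtain ⟨-, -, -, i₀, -⟩ := id h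
    rw [← h.1]
    exact_mod_cast Fintype.card_pos_iff.mpr ⟨i₀⟩
  have h11 : (1 : V → ℝ) ⬝ᵥ 1 = n := by simp [← h.1]
  set m : ℝ := (1 ⬝ᵥ g) / n with hm
  have hmn : m * n = 1 ⬝ᵥ g := div_mul_cancel₀ _ hn.ne'
  have hg0 : 1 ⬝ᵥ (g - m • 1) = 0 := by
    rw [dotProduct_sub, dotProduct_smul, h11, smul_eq_mul, hmn, sub_self]
  have hgg : (g - m • 1) ⬝ᵥ (g - m • 1) ≤ g ⬝ᵥ g := by
    rw [sub_dotProduct, smul_dotProduct, hg0, dotProduct_sub, dotProduct_smul,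
      dotProduct_comm g 1, ← hmn, smul_zero, smul_eq_mul]
    nlinarith [sq_nonneg m]
  have hfg : f ⬝ᵥ G.adjMatrix ℝ *ᵥ (g - m • 1)
      = f ⬝ᵥ G.adjMatrix ℝ *ᵥ g - d * (1 ⬝ᵥ f) * (1 ⬝ᵥ g) / n := by
    rw [mulVec_sub, mulVec_smul, h.adjMatrix_mulVec_one, dotProduct_sub, dotProduct_smul,
      dotProduct_smul, dotProduct_comm f 1, hm, smul_eq_mul, smul_eq_mul]
    ring
  have hcs : (f ⬝ᵥ G.adjMatrix ℝ *ᵥ (g - m • 1)) ^ 2 ≤ (f ⬝ᵥ f) *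
      ((G.adjMatrix ℝ *ᵥ (g - m • 1)) ⬝ᵥ (G.adjMatrix ℝ *ᵥ (g - m • 1))) := by
    simpa [dotProduct, ← sq] using
      Finset.sum_mul_sq_le_sq_mul_sq Finset.univ f (G.adjMatrix ℝ *ᵥ (g - m • 1))
  have hff : 0 ≤ f ⬝ᵥ f := Finset.sum_nonneg fun i _ => mul_self_nonneg (f i)
  rw [← hfg]
  calc _ ≤ _ := hcs
    _ ≤ (f ⬝ᵥ f) * (lam ^ 2 * (g ⬝ᵥ g)) := by
      refine mul_le_mul_of_nonneg_left ?_ hff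
      exact (h.adjMatrix_mulVec_dotProduct_self_le hlam hg0).trans
        (mul_le_mul_of_nonneg_left hgg (sq_nonneg _))
    _ = _ := by ring

end IsNDL

/-- The numerical contradiction behind the connectivity bound: `u`, `s`, `w` are the sizes of a
small side, a separator and a large side; `p`, `q` count edges inside the small side and from it
to the separator. -/
lemma false_of_small_separator {n d u s w lam p q : ℝ} (hd : 0 < d) (hdn : 2 * d ≤ n)
    (hlam : 0 ≤ lam) (hu : 0 < u) (hs : 0 ≤ s) (huw : u ≤ w) (hsum : u + s + w = n)
    (hsd : s < d - 36 * lam ^ 2 / d) (hdeg : d ≤ u + s) (hpq : p + q = d * u)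
    (hUW : (0 - d * u * w / n) ^ 2 ≤ lam ^ 2 * u * w)
    (hUU : (p - d * u * u / n) ^ 2 ≤ lam ^ 2 * u * u)
    (hUS : (q - d * u * s / n) ^ 2 ≤ lam ^ 2 * u * s) : False := by
  have hn : 0 < n := by linarith
  have hw : 0 < w := by linarith
  have hdiv : 36 * lam ^ 2 / d * d = 36 * lam ^ 2 := div_mul_cancel₀ _ hd.ne'
  have hdiv0 : 0 ≤ 36 * lam ^ 2 / d := by positivity
  have hs' : s < d := by linarith
  have hud : 36 * lam ^ 2 ≤ d * u := by
    rw [← hdiv, mul_comm d u]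
    exact mul_le_mul_of_nonneg_right (by linarith) hd.le
  have hlam6 : 6 * lam ≤ d := by
    have : 36 * lam ^ 2 ≤ d * d := by
      rw [← hdiv]
      exact mul_le_mul_of_nonneg_right (by linarith) hd.le
    exact le_of_sq_le_sq (by nlinarith) hd.le
  have hw4 : n ≤ 4 * w := by linarith
  have huw' : d ^ 2 * (u * w) ≤ lam ^ 2 * n ^ 2 := by
    have h1 : d ^ 2 * (u * w) * (u * w) ≤ lam ^ 2 * n ^ 2 * (u * w) := by
      have h2 : (0 - d * u * w / n) ^ 2 * n ^ 2 = d ^ 2 * (u * w) * (u * w) := by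
        field_simp
        ring
      nlinarith [mul_le_mul_of_nonneg_right hUW (sq_nonneg n)]
    exact le_of_mul_le_mul_right h1 (by positivity)
  have hu_small : d * u / n ≤ d / 9 := by
    rw [div_le_iff₀ hn]
    have h1 : d ^ 2 * u * n ≤ 4 * lam ^ 2 * n * n := by
      nlinarith [mul_le_mul_of_nonneg_left hw4 (by positivity : 0 ≤ d ^ 2 * u)]
    have h2 : d ^ 2 * u ≤ 4 * lam ^ 2 * n := le_of_mul_le_mul_right h1 hn
    have h3 : 36 * lam ^ 2 ≤ d ^ 2 := by nlinarith
    have h4 : d * (d * u) ≤ d * (d / 9 * n) := by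
      nlinarith [mul_le_mul_of_nonneg_right h3 hn.le]
    exact le_of_mul_le_mul_left h4 hd
  have hp : p ≤ 5 / 18 * (d * u) := by
    have h1 : p - d * u * u / n ≤ lam * u := le_of_sq_le_sq (by nlinarith) (by positivity)
    have h2 : d * u * u / n = d * u / n * u := by ring
    have h3 := mul_le_mul_of_nonneg_right hu_small hu.le
    have h4 := mul_le_mul_of_nonneg_right hlam6 hu.le
    linarith
  have hq : q ≤ 2 / 3 * (d * u) := by
    have h1 : q - d * u * s / n ≤ d * u / 6 := by
      refine le_of_sq_le_sq (hUS.trans ?_) (by positivity)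
      have h2 := mul_le_mul_of_nonneg_left hs'.le (by positivity : 0 ≤ lam ^ 2 * u)
      have h3 := mul_le_mul_of_nonneg_right hud (by positivity : 0 ≤ d * u)
      nlinarith
    have h2 : d * u * s / n ≤ d * u / 2 := by
      rw [div_le_div_iff₀ hn two_pos]
      have := mul_le_mul_of_nonneg_left (by linarith : s * 2 ≤ n) (by positivity : 0 ≤ d * u)
      linarith
    linarith
  have : 0 < d * u := by positivity
  linarith

open Matrix in
/-- A separator of an `(n,d,λ)`-graph with `2 * d ≤ n` has at least `d - 36λ²/d` vertices. -/
lemma IsNDL.le_card_of_separates {V : Type*} [Fintype V] [DecidableEq V] {G : SimpleGraph V}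
    [DecidableRel G.Adj] {n d : ℕ} {lam : ℝ} (h : IsNDL G n d lam) (hd : 2 * d ≤ n)
    {U S W : Finset V} (hUS : Disjoint U S) (hUSW : Disjoint (U ∪ S) W)
    (hcover : U ∪ S ∪ W = Finset.univ) (hU : U.Nonempty) (hle : U.card ≤ W.card)
    (hadj : ∀ u ∈ U, ∀ w ∈ W, ¬ G.Adj u w) :
    (d : ℝ) - 36 * lam ^ 2 / d ≤ S.card := by
  by_contra! hS
  obtain ⟨hn, hreg, _, i₀, -, hev⟩ := id h
  obtain ⟨u, hu⟩ := hU
  have hupos : 0 < U.card := Finset.card_pos.mpr ⟨u, hu⟩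
  have hd0 : (0 : ℝ) < d := by
    have : 0 ≤ 36 * lam ^ 2 / (d : ℝ) := by positivity
    have : (0 : ℝ) ≤ S.card := by positivity
    linarith
  have hsum : U.card + S.card + W.card = n := by
    rw [← hn, ← Finset.card_univ, ← hcover, Finset.card_union_of_disjoint hUSW,
      Finset.card_union_of_disjoint hUS]
  have hlam0 : 0 ≤ lam := by
    have : 1 < Fintype.card V := by omega
    obtain ⟨i, hi⟩ := Fintype.exists_ne_of_one_lt_card this i₀
    exact (abs_nonneg _).trans (hev i hi)
  have hlam : lam < d := by
    by_contra! hcon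
    have h1 : (d : ℝ) ≤ 36 * lam ^ 2 / d := by
      rw [le_div_iff₀ hd0]
      nlinarith
    have : (0 : ℝ) ≤ S.card := by positivity
    linarith
  have hdeg : d ≤ U.card + S.card := by
    rw [← hreg u, ← SimpleGraph.card_neighborFinset_eq_degree,
      ← Finset.card_union_of_disjoint hUS]
    refine Finset.card_le_card fun v hv => ?_
    have hv' : v ∈ U ∪ S ∪ W := hcover ▸ Finset.mem_univ v
    exact (Finset.mem_union.mp hv').resolve_right fun hw =>
      hadj u hu v hw ((G.mem_neighborFinset u v).mp hv)
  let ind : Finset V → V → ℝ := fun X v => if v ∈ X then 1 else 0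
  have hone (X : Finset V) : 1 ⬝ᵥ ind X = X.card := by simp [ind, dotProduct]
  have hself (X : Finset V) : ind X ⬝ᵥ ind X = X.card := by simp [ind, dotProduct]
  have hind : ind U + ind S + ind W = 1 := by
    ext v
    have hv : v ∈ U ∪ S ∪ W := hcover ▸ Finset.mem_univ v
    have h1 : v ∈ U → v ∉ S := fun hvU => Finset.disjoint_left.mp hUS hvU
    have h2 : v ∈ U ∪ S → v ∉ W := fun hvUS => Finset.disjoint_left.mp hUSW hvUS
    simp only [Finset.mem_union] at hv h2
    by_cases hvU : v ∈ U <;> by_cases hvS : v ∈ S <;> by_cases hvW : v ∈ W <;>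
      simp_all [ind]
  have hUW : ind U ⬝ᵥ G.adjMatrix ℝ *ᵥ ind W = 0 := by
    refine Finset.sum_eq_zero fun v _ => ?_
    by_cases hv : v ∈ U
    · rw [SimpleGraph.adjMatrix_mulVec_apply]
      refine mul_eq_zero_of_right _ (Finset.sum_eq_zero fun w hw => if_neg fun hwW => ?_)
      exact hadj v hv w hwW ((G.mem_neighborFinset v w).mp hw)
    · simp [ind, hv]
  have hpq : ind U ⬝ᵥ G.adjMatrix ℝ *ᵥ ind U + ind U ⬝ᵥ G.adjMatrix ℝ *ᵥ ind S
      = d * U.card := by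
    have h1 : ind U ⬝ᵥ G.adjMatrix ℝ *ᵥ (ind U + ind S + ind W) = d * U.card := by
      rw [hind, h.adjMatrix_mulVec_one, dotProduct_smul, dotProduct_comm, hone, smul_eq_mul]
    rwa [mulVec_add, mulVec_add, dotProduct_add, dotProduct_add, hUW, add_zero] at h1
  have hmix (X Y : Finset V) := h.sq_mixing_le hlam (ind X) (ind Y)
  simp only [hone, hself] at hmix
  exact false_of_small_separator hd0 (by exact_mod_cast hd) hlam0 (by exact_mod_cast hupos)
    (Nat.cast_nonneg _) (by exact_mod_cast hle) (by exact_mod_cast hsum) hS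
    (by exact_mod_cast hdeg) hpq (hUW ▸ hmix U W) (hmix U U) (hmix U S)

/-- Let `G` be an `(n,d,λ)`-graph with `d ≤ n/2`. Then the vertex-connectivity of `G` is at
least `d − 36λ²/d`: deleting fewer than `d − 36λ²/d` vertices leaves an induced subgraph that
is still connected. -/
theorem stmt_5 {V : Type*} [Fintype V] [DecidableEq V] (G : SimpleGraph V)
    [DecidableRel G.Adj] (n d : ℕ) (lam : ℝ)
    (h : IsNDL G n d lam) (hd : 2 * d ≤ n) :
    ∀ S : Finset V, (S.card : ℝ) < (d : ℝ) - 36 * lam ^ 2 / d →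
      (G.induce ((↑S : Set V)ᶜ)).Connected := by
  classical
  intro S hS
  have hSd : S.card < d := by
    have : 0 ≤ 36 * lam ^ 2 / (d : ℝ) := by positivity
    exact_mod_cast (by linarith : (S.card : ℝ) < d)
  have hne : Nonempty ↑((↑S : Set V)ᶜ) := by
    obtain ⟨v, hv⟩ : ∃ v, v ∉ S := by
      by_contra! hall
      have := Finset.card_univ (α := V)
      rw [← Finset.eq_univ_iff_forall.mpr hall, h.1] at this
      omega
    exact ⟨v, by simpa using hv⟩
  refine { preconnected := fun a b => ?_, nonempty := hne }
  by_contra hab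
  let U : Finset V := {v | ∃ hv : v ∈ (↑S : Set V)ᶜ, (G.induce (↑S : Set V)ᶜ).Reachable a ⟨v, hv⟩}
  let W : Finset V := (U ∪ S)ᶜ
  have haU : a.1 ∈ U := Finset.mem_filter_univ _ |>.mpr ⟨a.2, SimpleGraph.Reachable.refl a⟩
  have hbW : b.1 ∈ W := by
    have hbS : b.1 ∉ S := b.2
    simp only [W, U, Finset.mem_compl, Finset.mem_union, Finset.mem_filter_univ, not_or]
    exact ⟨fun ⟨_, hb⟩ => hab hb, hbS⟩
  have hUS : Disjoint U S := by
    refine Finset.disjoint_left.mpr fun v hv hvS => ?_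
    obtain ⟨hv', -⟩ := Finset.mem_filter_univ v |>.mp hv
    exact hv' hvS
  have hUSW : Disjoint (U ∪ S) W := disjoint_compl_right
  have hcover : U ∪ S ∪ W = Finset.univ := Finset.union_compl _
  have hadj : ∀ u ∈ U, ∀ w ∈ W, ¬ G.Adj u w := by
    intro u hu w hw huw
    obtain ⟨hu', hau⟩ := Finset.mem_filter_univ u |>.mp hu
    simp only [W, Finset.mem_compl, Finset.mem_union, not_or] at hw
    have hw' : w ∈ (↑S : Set V)ᶜ := by simpa using hw.2
    refine hw.1 (Finset.mem_filter_univ w |>.mpr ⟨hw', hau.trans ?_⟩)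
    exact SimpleGraph.Adj.reachable (by simpa using huw)
  obtain hle | hle := le_total U.card W.card
  · exact hS.not_ge (h.le_card_of_separates hd hUS hUSW hcover ⟨_, haU⟩ hle hadj)
  · have hWS : Disjoint W S := (hUSW.mono_left Finset.subset_union_right).symm
    have hWU : Disjoint W U := (hUSW.mono_left Finset.subset_union_left).symm
    refine hS.not_ge (h.le_card_of_separates hd hWS
      (Finset.disjoint_union_left.mpr ⟨hWU, hUS.symm⟩) ?_ ⟨_, hbW⟩ hle
      fun w hw u hu huw => hadj u hu w hw huw.symm)
    rw [← hcover, Finset.union_comm, Finset.union_comm W S, Finset.union_assoc]
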